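/- arXiv:1011.6214 — 2 statements merged into one kernel-verified Lean document; each statement's English description precedes it below -/
import Mathlib

section
/- Let β ∈ (1,2) and 0 < γ < δ ≤ 1/9. Then for every ξ ≥ δ: ω_{δ,γ}(2ξ) ≤ (3/2) ω_{δ,γ}(ξ). -/
open MeasureTheory Set Real

/-- The modulus of continuity `ω_{δ,γ}` from Section 4 (equation (4.13)). -/
noncomputable def omegaDG (β δ γ ξ : ℝ) : ℝ :=
  if ξ ≤ δ then ξ - ξ ^ ((3 : ℝ) / 2)
  else δ - δ ^ ((3 : ℝ) / 2) + ∫ η in Set.Ioc δ ξ, γ / (4 * (η + η ^ β))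

lemma omegaDG_of_le {β δ γ ξ : ℝ} (h : δ ≤ ξ) :
    omegaDG β δ γ ξ =
      δ - δ ^ ((3 : ℝ) / 2) + ∫ η in Set.Ioc δ ξ, γ / (4 * (η + η ^ β)) := by
  rcases h.eq_or_lt with rfl | h
  · simp [omegaDG]
  · rw [omegaDG, if_neg h.not_ge]

lemma omegaDG_integrand_nonneg {β γ η : ℝ} (hγ : 0 ≤ γ) (hη : 0 < η) :
    0 ≤ γ / (4 * (η + η ^ β)) := by
  have := rpow_pos_of_pos hη β
  positivity

lemma integrableOn_omegaDG_integrand (β γ : ℝ) {a b : ℝ} (ha : 0 < a) :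
    IntegrableOn (fun η : ℝ => γ / (4 * (η + η ^ β))) (Ioc a b) := by
  refine (ContinuousOn.integrableOn_Icc ?_).mono_set Ioc_subset_Icc_self
  have hpos : ∀ η ∈ Icc a b, 0 < η := fun η hη => ha.trans_le hη.1
  refine continuousOn_const.div (continuousOn_const.mul (continuousOn_id.add
    (continuousOn_id.rpow_const fun η hη => Or.inl (hpos η hη).ne'))) fun η hη => ?_
  have h0 := hpos η hη
  have h1 := rpow_pos_of_pos h0 β
  positivity

lemma setIntegral_omegaDG_integrand_le (β : ℝ) {γ ξ : ℝ} (hγ : 0 ≤ γ) (hξ : 0 < ξ) :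
    ∫ η in Ioc ξ (2 * ξ), γ / (4 * (η + η ^ β)) ≤ γ / 4 := by
  calc ∫ η in Ioc ξ (2 * ξ), γ / (4 * (η + η ^ β))
      ≤ ∫ _ in Ioc ξ (2 * ξ), γ / (4 * ξ) := by
        refine setIntegral_mono_on (integrableOn_omegaDG_integrand β γ hξ)
          (integrableOn_const (by simp)) measurableSet_Ioc fun η hη => ?_
        have h1 := rpow_pos_of_pos (hξ.trans hη.1) β
        have h2 := hη.1
        gcongr
        linarith
    _ = γ / 4 := by
        rw [setIntegral_const, volume_real_Ioc_of_le (by linarith), smul_eq_mul]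
        field_simp
        ring

lemma half_le_sub_rpow_three_halves {δ : ℝ} (h0 : 0 ≤ δ) (hδ : δ ≤ 1 / 9) :
    δ / 2 ≤ δ - δ ^ ((3 : ℝ) / 2) := by
  have hs : √δ ≤ 1 / 3 := (sqrt_le_left (by norm_num)).2 (by linarith)
  have hr : δ ^ ((3 : ℝ) / 2) = δ * √δ := by
    rw [sqrt_eq_rpow, show (3 : ℝ) / 2 = 1 + 1 / 2 by norm_num,
      rpow_add_of_nonneg h0 (by norm_num) (by norm_num), rpow_one]
  nlinarith

/-- the doubling bound `ω_{δ,γ}(2ξ) ≤ (3/2) ω_{δ,γ}(ξ)` for `ξ ≥ δ`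
from Case 2 of Section 4. -/
theorem stmt11 (β δ γ : ℝ) (hβ : β ∈ Set.Ioo (1 : ℝ) 2)
    (hγ : 0 < γ) (hγδ : γ < δ) (hδ : δ ≤ 1 / 9) :
    ∀ ξ ≥ δ, omegaDG β δ γ (2 * ξ) ≤ 3 / 2 * omegaDG β δ γ ξ := by
  intro ξ hξ
  have hδ0 : 0 < δ := hγ.trans hγδ
  have hξ0 : 0 < ξ := hδ0.trans_le hξ
  have hξ2 : ξ ≤ 2 * ξ := by linarith
  rw [omegaDG_of_le (hξ.le.trans hξ2), omegaDG_of_le hξ, ← Ioc_union_Ioc_eq_Ioc hξ hξ2,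
    setIntegral_union (Ioc_disjoint_Ioc_of_le le_rfl) measurableSet_Ioc
      (integrableOn_omegaDG_integrand β γ hδ0) (integrableOn_omegaDG_integrand β γ hξ0)]
  have h1 := setIntegral_omegaDG_integrand_le β hγ.le hξ0
  have h2 := half_le_sub_rpow_three_halves hδ0.le hδ
  have h3 : 0 ≤ ∫ η in Ioc δ ξ, γ / (4 * (η + η ^ β)) :=
    setIntegral_nonneg measurableSet_Ioc fun η hη =>
      omegaDG_integrand_nonneg hγ.le (hδ0.trans hη.1)
  linarith
end

section
/- Let α ∈ (0,1), γ ∈ (0,1), H > 0, δ > 0 and 0 < ξ₀ ≤ δ. Then for every ξ ∈ (0, ξ₀]: ξ ∫_ξ^∞ ω(η;ξ₀) η^{−(2+α)} dη ≤ (1/(1−γ)) · (1/(1+α) + 1/(1+α−γ)) · ξ^{−α} ω(ξ;ξ₀). -/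
open MeasureTheory Set Real

/-- The variant modulus of continuity `ω(·;ξ₀)` from (5.5). -/
noncomputable def omegaVar (H δ γ ξ₀ ξ : ℝ) : ℝ :=
  if ξ ≤ ξ₀ then γ * H * δ ^ (-γ) * ξ₀ ^ (γ - 1) * ξ + (1 - γ) * H * δ ^ (-γ) * ξ₀ ^ γ
  else if ξ ≤ δ then H / δ ^ γ * ξ ^ γ
  else H

/-- Below the scale `ξ₀` the modulus is comparable to its value at `ξ₀`. -/
theorem one_sub_mul_le_omegaVar {γ H δ ξ₀ ξ : ℝ} (hγ : 0 ≤ γ) (hH : 0 ≤ H) (hδ : 0 ≤ δ)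
    (hξ : 0 ≤ ξ) (hξξ₀ : ξ ≤ ξ₀) :
    (1 - γ) * (H * δ ^ (-γ) * ξ₀ ^ γ) ≤ omegaVar H δ γ ξ₀ ξ := by
  have hξ₀ : 0 ≤ ξ₀ := hξ.trans hξξ₀
  have : 0 ≤ γ * H * δ ^ (-γ) * ξ₀ ^ (γ - 1) * ξ := by positivity
  rw [omegaVar, if_pos hξξ₀]
  linarith

theorem omegaVar_nonneg {γ H δ ξ₀ ξ : ℝ} (hγ : γ ∈ Set.Icc (0 : ℝ) 1) (hH : 0 ≤ H) (hδ : 0 ≤ δ)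
    (hξ₀ : 0 ≤ ξ₀) (hξ : 0 ≤ ξ) : 0 ≤ omegaVar H δ γ ξ₀ ξ := by
  have h0 := hγ.1
  have h1 : 0 ≤ 1 - γ := sub_nonneg.2 hγ.2
  unfold omegaVar
  split_ifs <;> positivity

theorem omegaVar_le_mul_div_rpow {γ H δ ξ₀ ξ η : ℝ} (hγ : 0 ≤ γ) (hH : 0 ≤ H)
    (hδ : 0 < δ) (hξ : 0 < ξ) (hξξ₀ : ξ ≤ ξ₀) (hξη : ξ ≤ η) :
    omegaVar H δ γ ξ₀ η ≤ H * δ ^ (-γ) * ξ₀ ^ γ * (η / ξ) ^ γ := by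
  have hξ₀ : 0 < ξ₀ := hξ.trans_le hξξ₀
  have hη : 0 < η := hξ.trans_le hξη
  have key : H * δ ^ (-γ) * η ^ γ ≤ H * δ ^ (-γ) * ξ₀ ^ γ * (η / ξ) ^ γ := by
    rw [mul_assoc _ (ξ₀ ^ γ), ← mul_rpow hξ₀.le (by positivity)]
    gcongr
    rw [mul_div_assoc', le_div_iff₀ hξ, mul_comm]
    gcongr
  unfold omegaVar
  split_ifs with h₁ h₂
  · calc γ * H * δ ^ (-γ) * ξ₀ ^ (γ - 1) * η + (1 - γ) * H * δ ^ (-γ) * ξ₀ ^ γ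
        ≤ γ * H * δ ^ (-γ) * ξ₀ ^ (γ - 1) * ξ₀ + (1 - γ) * H * δ ^ (-γ) * ξ₀ ^ γ := by gcongr
      _ = H * δ ^ (-γ) * ξ₀ ^ γ * 1 := by
        rw [rpow_sub_one hξ₀.ne']
        field_simp
        ring
      _ ≤ _ := by
        gcongr
        exact one_le_rpow ((one_le_div hξ).2 hξη) hγ
  · rwa [div_eq_mul_inv, ← rpow_neg hδ.le]
  · refine le_trans ?_ key
    rw [rpow_neg hδ.le, mul_assoc, inv_mul_eq_div]
    refine le_mul_of_one_le_right hH ((one_le_div (by positivity)).2 ?_)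
    gcongr
    exact (not_le.1 h₂).le

/-- the tail estimate from the proof of (5.12) in Lemma 5.6 for the
variant modulus of continuity with positive value at the origin. -/
theorem stmt18 (α γ H δ ξ₀ : ℝ) (hα : α ∈ Set.Ioo (0 : ℝ) 1)
    (hγ : γ ∈ Set.Ioo (0 : ℝ) 1) (hH : 0 < H) (hδ : 0 < δ)
    (hξ₀ : ξ₀ ∈ Set.Ioc (0 : ℝ) δ) :
    ∀ ξ ∈ Set.Ioc (0 : ℝ) ξ₀,
      ξ * (∫ η in Set.Ioi ξ, omegaVar H δ γ ξ₀ η / η ^ (2 + α)) ≤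
        1 / (1 - γ) * (1 / (1 + α) + 1 / (1 + α - γ)) *
          (ξ ^ (-α) * omegaVar H δ γ ξ₀ ξ) := by
  intro ξ hξ
  obtain ⟨hα0, -⟩ := hα
  obtain ⟨hγ0, hγ1⟩ := hγ
  obtain ⟨hξ0, hξξ₀⟩ := hξ
  have hξ₀0 := hξ₀.1
  have hγ' : 0 < 1 - γ := sub_pos.2 hγ1
  have hβ : 0 < 1 + α - γ := by linarith
  set K := H * δ ^ (-γ) * ξ₀ ^ γ
  have hK0 : 0 ≤ K := by positivity
  have hexp : γ - (2 + α) < -1 := by linarith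
  have hint : ∫ η in Set.Ioi ξ, omegaVar H δ γ ξ₀ η / η ^ (2 + α) ≤
      ∫ η in Set.Ioi ξ, K / ξ ^ γ * η ^ (γ - (2 + α)) := by
    refine integral_mono_of_nonneg ?_ ((integrableOn_Ioi_rpow_of_lt hexp hξ0).const_mul _) ?_
    · filter_upwards [ae_restrict_mem measurableSet_Ioi] with η hη
      have hη0 : 0 ≤ η := (hξ0.trans hη).le
      exact div_nonneg (omegaVar_nonneg ⟨hγ0.le, hγ1.le⟩ hH.le hδ.le hξ₀0.le hη0)
        (rpow_nonneg hη0 _)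
    · filter_upwards [ae_restrict_mem measurableSet_Ioi] with η hη
      have hη0 : 0 < η := hξ0.trans hη
      calc omegaVar H δ γ ξ₀ η / η ^ (2 + α) ≤ K * (η / ξ) ^ γ / η ^ (2 + α) := by
            gcongr
            exact omegaVar_le_mul_div_rpow hγ0.le hH.le hδ hξ0 hξξ₀ (le_of_lt hη)
        _ = K / ξ ^ γ * η ^ (γ - (2 + α)) := by
            rw [div_rpow hη0.le hξ0.le, rpow_sub hη0]
            ring
  rw [integral_const_mul, integral_Ioi_rpow_of_lt hexp hξ0] at hint
  have hpow : ξ * (ξ ^ (γ - (2 + α) + 1) / ξ ^ γ) = ξ ^ (-α) := by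
    rw [← rpow_sub hξ0, ← rpow_one_add' hξ0.le (by linarith)]
    ring_nf
  have hω : K ≤ 1 / (1 - γ) * omegaVar H δ γ ξ₀ ξ := by
    rw [one_div_mul_eq_div, le_div_iff₀ hγ', mul_comm]
    exact one_sub_mul_le_omegaVar hγ0.le hH.le hδ.le hξ0.le hξξ₀
  calc ξ * ∫ η in Set.Ioi ξ, omegaVar H δ γ ξ₀ η / η ^ (2 + α)
      ≤ ξ * (K / ξ ^ γ * (-ξ ^ (γ - (2 + α) + 1) / (γ - (2 + α) + 1))) := by gcongr
    _ = 1 / (1 + α - γ) * (ξ ^ (-α) * K) := by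
      rw [← hpow, show γ - (2 + α) + 1 = -(1 + α - γ) by ring, neg_div_neg_eq]
      ring
    _ ≤ (1 / (1 + α) + 1 / (1 + α - γ)) *
          (ξ ^ (-α) * (1 / (1 - γ) * omegaVar H δ γ ξ₀ ξ)) := by
      gcongr
      exact le_add_of_nonneg_left (by positivity)
    _ = _ := by ring
end
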